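/- (Proposition 3.8.) Let a ∈ (ℂ^×)^n. Suppose that p does not vanish identically on the set {a⊙v : v ∈ (ℂ^×)^{n−m}}, where a⊙v denotes the point whose j-th coordinate is a_j for 1 ≤ j ≤ m and a_j·v_{j−m} for m < j ≤ n, and suppose that for every Laurent polynomial ψ ∈ ℂ[z₁^{±1},…,z_n^{±1}] one has ∫_{(S¹)^{n−m}} [D_λ( p̃(λ) · p_{a⊙u}(λ) · ψ_{a⊙u}(λ) )]_{λ=0} du = 0. Then D = 0, i.e. c_β = 0 for every β ∈ B. -/

import Mathlib

open MeasureTheory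

/-- Evaluation of a Laurent polynomial (a finitely supported family of coefficients indexed
by `ℤⁿ`) at a point of `ℂⁿ` with nonzero coordinates (using `zpow` on the field `ℂ`). -/
noncomputable def laurentEvalC {n : ℕ} (f : (Fin n → ℤ) →₀ ℂ) (z : Fin n → ℂ) : ℂ :=
  f.sum fun e c => c * ∏ i, z i ^ e i

/-- The point `b ⊙ e(λ)` of `ℂⁿ`: its `j`-th coordinate is `b j · exp(λ j · log q)` for
`j < m` and `b j` for `m ≤ j`. -/
noncomputable def emap {n : ℕ} (m : ℕ) (q : ℝ) (b : Fin n → ℂ) (lam : Fin m → ℂ) :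
    Fin n → ℂ :=
  fun j => if h : (j : ℕ) < m then b j * Complex.exp (lam ⟨j, h⟩ * Real.log q) else b j

/-- The partial derivative of `f : ℂᵐ → ℂ` in the `i`-th coordinate direction. -/
noncomputable def pderivC {m : ℕ} (i : Fin m) (f : (Fin m → ℂ) → ℂ) : (Fin m → ℂ) → ℂ :=
  fun x => fderiv ℂ f x (Pi.single i 1)

/-- The iterated partial derivative `∂^β` of `f : ℂᵐ → ℂ` for a multi-index `β ∈ ℕᵐ`. -/
noncomputable def mderiv {m : ℕ} (β : Fin m → ℕ) (f : (Fin m → ℂ) → ℂ) :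
    (Fin m → ℂ) → ℂ :=
  (List.finRange m).foldr (fun i g => (pderivC i)^[β i] g) f

/-- The point `a ⊙ u` of `ℂⁿ`, where `u ∈ (S¹)^{n-m}` is parametrized by
`t ∈ ℝ^{n-m}` via `u_j = exp(2πi t_j)`: its `j`-th coordinate is `a j` for `j < m` and
`a j · exp(2πi t_{j-m})` for `m ≤ j`. -/
noncomputable def adotu {n : ℕ} (m : ℕ) (a : Fin n → ℂ) (t : Fin (n - m) → ℝ) :
    Fin n → ℂ :=
  fun j => if h : (j : ℕ) < m then a j
    else a j * Complex.exp (2 * Real.pi * Complex.I *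
      (t ⟨(j : ℕ) - m, by have := j.isLt; omega⟩))

/-- The point `a ⊙ v` of `ℂⁿ` for `v ∈ (ℂˣ)^{n-m}`: its `j`-th coordinate is `a j` for
`j < m` and `a j · v_{j-m}` for `m ≤ j`. -/
noncomputable def adotv {n : ℕ} (m : ℕ) (a : Fin n → ℂ) (v : Fin (n - m) → ℂˣ) :
    Fin n → ℂ :=
  fun j => if h : (j : ℕ) < m then a j
    else a j * (v ⟨(j : ℕ) - m, by have := j.isLt; omega⟩ : ℂ)

/-- `f` agrees near `0` with `H(λ) ∏ⱼ (exp(λⱼ L) - 1)^{γⱼ}` for some `H` analytic at `0` with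
`H(0) = v`. -/
def HasExpFactor {m : ℕ} (L : ℂ) (γ : Fin m → ℕ) (v : ℂ) (f : (Fin m → ℂ) → ℂ) : Prop :=
  ∃ H : (Fin m → ℂ) → ℂ, AnalyticAt ℂ H 0 ∧ H 0 = v ∧
    f =ᶠ[nhds 0] fun x => H x * ∏ j, (Complex.exp (x j * L) - 1) ^ γ j

theorem analyticAt_pderivC {m : ℕ} (i : Fin m) {H : (Fin m → ℂ) → ℂ} {x : Fin m → ℂ}
    (hH : AnalyticAt ℂ H x) : AnalyticAt ℂ (pderivC i H) x :=
  ((ContinuousLinearMap.apply ℂ ℂ (Pi.single i (1 : ℂ) : Fin m → ℂ)).analyticAt _).comp hH.fderiv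

theorem hasFDerivAt_exp_coord {m : ℕ} (L : ℂ) (j : Fin m) (x : Fin m → ℂ) :
    HasFDerivAt (fun y : Fin m → ℂ => Complex.exp (y j * L) - 1)
      ((Complex.exp (x j * L) * L) • ContinuousLinearMap.proj (R := ℂ) (φ := fun _ : Fin m => ℂ) j)
      x := by
  have h1 : HasFDerivAt (fun y : Fin m → ℂ => y j)
      (ContinuousLinearMap.proj (R := ℂ) (φ := fun _ : Fin m => ℂ) j) x :=
    hasFDerivAt_apply j x
  have h2 := ((h1.mul_const L).cexp).sub_const 1
  rwa [smul_smul] at h2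

theorem pderivC_mul_pow {m : ℕ} (L : ℂ) (i : Fin m) (k : ℕ) {G R : (Fin m → ℂ) → ℂ}
    {x : Fin m → ℂ} (hG : DifferentiableAt ℂ G x) (hR : DifferentiableAt ℂ R x)
    (hR0 : pderivC i R x = 0) :
    pderivC i (fun y => G y * ((Complex.exp (y i * L) - 1) ^ k * R y)) x =
      pderivC i G x * ((Complex.exp (x i * L) - 1) ^ k * R x) +
      G x * (k * (Complex.exp (x i * L) - 1) ^ (k - 1) * (Complex.exp (x i * L) * L) * R x) := by
  have h := hG.hasFDerivAt.mul (((hasFDerivAt_exp_coord L i x).pow k).mul hR.hasFDerivAt)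
  unfold pderivC at hR0 ⊢
  have h' := congrArg (fun T : (Fin m → ℂ) →L[ℂ] ℂ => T (Pi.single i 1)) h.fderiv
  refine Eq.trans ?_ (h'.trans ?_)
  · rfl
  · simp [hR0]
    ring

theorem pderivC_prod_erase {m : ℕ} (L : ℂ) (i : Fin m) (γ : Fin m → ℕ) (x : Fin m → ℂ) :
    DifferentiableAt ℂ (fun y : Fin m → ℂ =>
      ∏ j ∈ Finset.univ.erase i, (Complex.exp (y j * L) - 1) ^ γ j) x ∧
    pderivC i (fun y : Fin m → ℂ =>
      ∏ j ∈ Finset.univ.erase i, (Complex.exp (y j * L) - 1) ^ γ j) x = 0 := by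
  have h := HasFDerivAt.finsetProd (u := Finset.univ.erase i) (x := x)
    (fun j _ => (hasFDerivAt_exp_coord L j x).pow (γ j))
  refine ⟨h.differentiableAt, ?_⟩
  unfold pderivC
  rw [h.fderiv, sum_apply]
  refine Finset.sum_eq_zero fun j hj => ?_
  simp [Pi.single_eq_of_ne (Finset.ne_of_mem_erase hj)]

theorem HasExpFactor.pderivC {m : ℕ} {L : ℂ} {γ : Fin m → ℕ} {v : ℂ}
    {f : (Fin m → ℂ) → ℂ} (hf : HasExpFactor L γ v f) (i : Fin m) :
    ∃ v', HasExpFactor L (Function.update γ i (γ i - 1)) v' (pderivC i f) ∧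
      (γ i ≠ 0 → v' = γ i * L * v) := by
  obtain ⟨H, hH, rfl, hfH⟩ := hf
  have hw : AnalyticAt ℂ (fun x : Fin m → ℂ => Complex.exp (x i * L)) 0 := by
    have : AnalyticAt ℂ (fun x : Fin m → ℂ => x i) 0 :=
      (ContinuousLinearMap.proj (R := ℂ) (φ := fun _ : Fin m => ℂ) i).analyticAt 0
    exact (this.mul analyticAt_const).cexp
  have key : _root_.pderivC i f =ᶠ[nhds 0] fun x =>
      _root_.pderivC i H x * ((Complex.exp (x i * L) - 1) ^ γ i *
        ∏ j ∈ Finset.univ.erase i, (Complex.exp (x j * L) - 1) ^ γ j) +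
      H x * (γ i * (Complex.exp (x i * L) - 1) ^ (γ i - 1) * (Complex.exp (x i * L) * L) *
        ∏ j ∈ Finset.univ.erase i, (Complex.exp (x j * L) - 1) ^ γ j) := by
    filter_upwards [hfH.eventuallyEq_nhds, hH.eventually_analyticAt] with x hx hHx
    obtain ⟨hR, hR0⟩ := pderivC_prod_erase L i γ x
    rw [← pderivC_mul_pow L i (γ i) hHx.differentiableAt hR hR0]
    unfold _root_.pderivC
    rw [hx.fderiv_eq]
    congr 2
    ext y
    rw [Finset.mul_prod_erase Finset.univ (fun j => (Complex.exp (y j * L) - 1) ^ γ j)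
      (Finset.mem_univ i)]
  have hprod : ∀ (x : Fin m → ℂ) (k : ℕ),
      ∏ j, (Complex.exp (x j * L) - 1) ^ (Function.update γ i k) j =
      (Complex.exp (x i * L) - 1) ^ k *
        ∏ j ∈ Finset.univ.erase i, (Complex.exp (x j * L) - 1) ^ γ j := by
    intro x k
    rw [← Finset.mul_prod_erase Finset.univ _ (Finset.mem_univ i), Function.update_self]
    congr 1
    refine Finset.prod_congr rfl fun j hj => ?_
    rw [Function.update_of_ne (Finset.ne_of_mem_erase hj)]
  rcases Nat.eq_zero_or_pos (γ i) with h0 | hpos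
  · refine ⟨_, ⟨_root_.pderivC i H, analyticAt_pderivC i hH, rfl, ?_⟩, fun h => absurd h0 h⟩
    filter_upwards [key] with x hx
    rw [hx, hprod, h0]
    simp
  · refine ⟨_, ⟨fun x => _root_.pderivC i H x * (Complex.exp (x i * L) - 1) +
      H x * (γ i * (Complex.exp (x i * L) * L)), ?_, rfl, ?_⟩, fun _ => ?_⟩
    · exact ((analyticAt_pderivC i hH).mul (hw.sub analyticAt_const)).add
        (hH.mul (analyticAt_const.mul (hw.mul analyticAt_const)))
    · filter_upwards [key] with x hx
      rw [hx, hprod]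
      obtain ⟨k, hk⟩ := Nat.exists_eq_succ_of_ne_zero hpos.ne'
      simp only [hk, Nat.succ_eq_add_one, Nat.add_sub_cancel]
      ring
    · simp
      ring

theorem HasExpFactor.iterate_pderivC {m : ℕ} {L : ℂ} {γ : Fin m → ℕ} {v : ℂ}
    {f : (Fin m → ℂ) → ℂ} (hf : HasExpFactor L γ v f) (i : Fin m) (b : ℕ) :
    ∃ v', HasExpFactor L (Function.update γ i (γ i - b)) v' ((_root_.pderivC i)^[b] f) ∧
      (b ≤ γ i → v' = (γ i).descFactorial b * L ^ b * v) := by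
  induction b with
  | zero => exact ⟨v, by simpa using hf, by simp⟩
  | succ b ih =>
    obtain ⟨v₁, h₁, e₁⟩ := ih
    obtain ⟨v₂, h₂, e₂⟩ := h₁.pderivC i
    refine ⟨v₂, ?_, fun hb => ?_⟩
    · rw [Function.iterate_succ_apply']
      simpa [Nat.sub_sub] using h₂
    · rw [e₂ (by simp; omega), e₁ (by omega), Nat.descFactorial_succ]
      simp
      ring

theorem HasExpFactor.foldr_pderivC {m : ℕ} {L : ℂ} {γ : Fin m → ℕ} {v : ℂ}
    {f : (Fin m → ℂ) → ℂ} (hf : HasExpFactor L γ v f) (β : Fin m → ℕ) (l : List (Fin m))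
    (hl : l.Nodup) :
    ∃ v', HasExpFactor L (fun j => if j ∈ l then γ j - β j else γ j) v'
        (l.foldr (fun i g => (_root_.pderivC i)^[β i] g) f) ∧
      (β = γ → v' = (l.map fun j => ((γ j).factorial : ℂ) * L ^ γ j).prod * v) := by
  induction l with
  | nil => exact ⟨v, by simpa using hf, by simp⟩
  | cons i l ih =>
    rw [List.nodup_cons] at hl
    obtain ⟨v₁, h₁, e₁⟩ := ih hl.2
    obtain ⟨v₂, h₂, e₂⟩ := h₁.iterate_pderivC i (β i)
    simp only [hl.1, if_false] at h₂ e₂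
    refine ⟨v₂, ?_, fun hβ => ?_⟩
    · rw [List.foldr_cons]
      convert h₂ using 1
      ext j
      rcases eq_or_ne j i with rfl | hj
      · simp
      · simp [hj]
    · subst hβ
      rw [e₂ le_rfl, e₁ rfl, Nat.descFactorial_self, List.map_cons, List.prod_cons]
      ring

theorem HasExpFactor.apply_zero {m : ℕ} {L : ℂ} {γ : Fin m → ℕ} {v : ℂ}
    {f : (Fin m → ℂ) → ℂ} (hf : HasExpFactor L γ v f) : f 0 = v * ∏ j, (0 : ℂ) ^ γ j := by
  obtain ⟨H, -, rfl, hfH⟩ := hf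
  simpa using hfH.self_of_nhds

theorem HasExpFactor.mderiv_eq_zero {m : ℕ} {L : ℂ} {γ : Fin m → ℕ} {v : ℂ}
    {f : (Fin m → ℂ) → ℂ} (hf : HasExpFactor L γ v f) {β : Fin m → ℕ} (h : ¬ γ ≤ β) :
    mderiv β f 0 = 0 := by
  obtain ⟨v', h', -⟩ := hf.foldr_pderivC β (List.finRange m) (List.nodup_finRange m)
  rw [Pi.le_def, not_forall] at h
  obtain ⟨j, hj⟩ := h
  refine h'.apply_zero.trans ?_
  rw [Finset.prod_eq_zero (Finset.mem_univ j), mul_zero]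
  simp only [List.mem_finRange, if_true]
  exact zero_pow (by omega)

theorem HasExpFactor.mderiv_self {m : ℕ} {L : ℂ} {γ : Fin m → ℕ} {v : ℂ}
    {f : (Fin m → ℂ) → ℂ} (hf : HasExpFactor L γ v f) :
    mderiv γ f 0 = (∏ j, ((γ j).factorial : ℂ) * L ^ γ j) * v := by
  obtain ⟨v', h', e'⟩ := hf.foldr_pderivC γ (List.finRange m) (List.nodup_finRange m)
  refine h'.apply_zero.trans ?_
  rw [e' rfl, ← List.ofFn_eq_map, List.prod_ofFn]
  simp

/-- `f` is given by a Laurent polynomial at points with nonzero coordinates. -/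
def IsLaurent {n : ℕ} (f : (Fin n → ℂ) → ℂ) : Prop :=
  ∃ ψ : (Fin n → ℤ) →₀ ℂ, ∀ z : Fin n → ℂ, (∀ i, z i ≠ 0) → laurentEvalC ψ z = f z

theorem laurentEvalC_add {n : ℕ} (φ ψ : (Fin n → ℤ) →₀ ℂ) (z : Fin n → ℂ) :
    laurentEvalC (φ + ψ) z = laurentEvalC φ z + laurentEvalC ψ z :=
  Finsupp.sum_add_index' (by simp) (by simp [add_mul])

theorem IsLaurent.monomial {n : ℕ} (c : ℂ) (e : Fin n → ℤ) :
    IsLaurent fun z : Fin n → ℂ => c * ∏ i, z i ^ e i :=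
  ⟨Finsupp.single e c, fun z _ => by simp [laurentEvalC]⟩

theorem IsLaurent.const {n : ℕ} (c : ℂ) : IsLaurent fun _ : Fin n → ℂ => c := by
  simpa using IsLaurent.monomial (n := n) c 0

theorem IsLaurent.coord_zpow {n : ℕ} (j : Fin n) (k : ℤ) :
    IsLaurent fun z : Fin n → ℂ => z j ^ k := by
  obtain ⟨ψ, hψ⟩ := IsLaurent.monomial (n := n) 1 (Pi.single j k)
  refine ⟨ψ, fun z hz => ?_⟩
  simp only [hψ z hz, one_mul]
  rw [Finset.prod_eq_single j]
  · simp
  · intro i _ hi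
    simp [hi]
  · simp

theorem IsLaurent.add {n : ℕ} {f g : (Fin n → ℂ) → ℂ} (hf : IsLaurent f) (hg : IsLaurent g) :
    IsLaurent fun z => f z + g z := by
  obtain ⟨φ, hφ⟩ := hf
  obtain ⟨ψ, hψ⟩ := hg
  exact ⟨φ + ψ, fun z hz => by rw [laurentEvalC_add, hφ z hz, hψ z hz]⟩

theorem IsLaurent.mul {n : ℕ} {f g : (Fin n → ℂ) → ℂ} (hf : IsLaurent f) (hg : IsLaurent g) :
    IsLaurent fun z => f z * g z := by
  obtain ⟨φ, hφ⟩ := hf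
  obtain ⟨ψ, hψ⟩ := hg
  suffices h : IsLaurent fun z : Fin n → ℂ => laurentEvalC φ z * laurentEvalC ψ z by
    obtain ⟨χ, hχ⟩ := h
    exact ⟨χ, fun z hz => by simp only [hχ z hz, hφ z hz, hψ z hz]⟩
  clear hφ hψ
  induction φ using Finsupp.induction_linear with
  | zero => simpa [laurentEvalC] using IsLaurent.const (n := n) 0
  | add φ₁ φ₂ h₁ h₂ => simpa only [laurentEvalC_add, add_mul] using h₁.add h₂
  | single e c =>
    induction ψ using Finsupp.induction_linear with
    | zero => simpa [laurentEvalC] using IsLaurent.const (n := n) 0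
    | add ψ₁ ψ₂ h₁ h₂ => simpa only [laurentEvalC_add, mul_add] using h₁.add h₂
    | single e' c' =>
      obtain ⟨χ, hχ⟩ := IsLaurent.monomial (n := n) (c * c') (e + e')
      refine ⟨χ, fun z hz => ?_⟩
      rw [hχ z hz]
      simp only [Pi.add_apply, zpow_add₀ (hz _), Finset.prod_mul_distrib]
      simp [laurentEvalC]
      ring

theorem IsLaurent.pow {n : ℕ} {f : (Fin n → ℂ) → ℂ} (hf : IsLaurent f) (k : ℕ) :
    IsLaurent fun z => f z ^ k := by
  induction k with
  | zero => simpa using IsLaurent.const (n := n) 1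
  | succ k ih => simpa only [pow_succ] using ih.mul hf

theorem IsLaurent.prod {n : ℕ} {ι : Type*} (s : Finset ι) {f : ι → (Fin n → ℂ) → ℂ}
    (hf : ∀ i, IsLaurent (f i)) : IsLaurent fun z => ∏ i ∈ s, f i z := by
  classical
  induction s using Finset.induction_on with
  | empty => simpa using IsLaurent.const (n := n) 1
  | insert i s hi ih => simpa only [Finset.prod_insert hi] using (hf i).mul ih

/-- The embedding of the last `n - m` indices into `Fin n`. -/
def tailIdx {n m : ℕ} (j : Fin (n - m)) : Fin n := ⟨m + j, by have := j.isLt; omega⟩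

theorem prod_head_mul_prod_tail {n m : ℕ} (hnm : m ≤ n) (f : Fin n → ℂ) :
    ∏ i, f i = (∏ j : Fin m, f (Fin.castLE hnm j)) * ∏ j : Fin (n - m), f (tailIdx j) := by
  have aux : ∀ r (h : m + r = n), ∏ i, f i = (∏ j : Fin m, f (Fin.castLE hnm j)) *
      ∏ j : Fin r, f ⟨m + j, by have := j.isLt; omega⟩ := by
    rintro r rfl
    exact Fin.prod_univ_add f
  exact aux (n - m) (by omega)

theorem adotv_castLE {n m : ℕ} (hnm : m ≤ n) (a : Fin n → ℂ) (v : Fin (n - m) → ℂˣ)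
    (j : Fin m) : adotv m a v (Fin.castLE hnm j) = a (Fin.castLE hnm j) := by
  simp [adotv]

theorem adotv_tailIdx {n m : ℕ} (a : Fin n → ℂ) (v : Fin (n - m) → ℂˣ)
    (j : Fin (n - m)) : adotv m a v (tailIdx j) = a (tailIdx j) * v j := by
  simp [adotv, tailIdx]

theorem laurentEvalC_adotv {n m : ℕ} (hnm : m ≤ n) (p : (Fin n → ℤ) →₀ ℂ) (a : Fin n → ℂ)
    (v : Fin (n - m) → ℂˣ) :
    laurentEvalC p (adotv m a v) =
      ∑ e ∈ p.support, (p e * ∏ i, a i ^ e i) * ∏ j, (v j : ℂ) ^ e (tailIdx j) := by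
  unfold laurentEvalC Finsupp.sum
  refine Finset.sum_congr rfl fun e _ => ?_
  dsimp only
  rw [prod_head_mul_prod_tail hnm, prod_head_mul_prod_tail hnm]
  simp only [adotv_castLE, adotv_tailIdx, mul_zpow, Finset.prod_mul_distrib]
  ring

/-- Some coefficient of `p`, viewed as a Laurent polynomial in the last `n - m` variables after
specializing the first `m` ones, is nonzero. -/
theorem exists_tail_coeff_ne_zero {n m : ℕ} (hnm : m ≤ n) {p : (Fin n → ℤ) →₀ ℂ}
    {a : Fin n → ℂ} {v : Fin (n - m) → ℂˣ} (h : laurentEvalC p (adotv m a v) ≠ 0) :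
    ∃ k : Fin (n - m) → ℤ,
      ∑ e ∈ p.support with (fun j => e (tailIdx j)) = k, p e * ∏ i, a i ^ e i ≠ 0 := by
  classical
  by_contra! hk
  refine h ?_
  rw [laurentEvalC_adotv hnm, ← Finset.sum_fiberwise_of_maps_to
    (t := p.support.image fun e (j : Fin (n - m)) => e (tailIdx j))
    (g := fun e (j : Fin (n - m)) => e (tailIdx j))
    (fun e he => Finset.mem_image_of_mem _ he)]
  refine Finset.sum_eq_zero fun k _ => ?_
  trans (∑ e ∈ p.support with (fun j => e (tailIdx j)) = k, p e * ∏ i, a i ^ e i) *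
    ∏ j, (v j : ℂ) ^ k j
  · rw [Finset.sum_mul]
    refine Finset.sum_congr rfl fun e he => ?_
    rw [← (Finset.mem_filter.1 he).2]
  · rw [hk k, zero_mul]

theorem setIntegral_cube_character {r : ℕ} (d : Fin r → ℤ) :
    ∫ t in (Set.univ.pi fun _ : Fin r => Set.Ioc (0 : ℝ) 1),
      ∏ j, Complex.exp (2 * Real.pi * Complex.I * t j) ^ d j = if d = 0 then 1 else 0 := by
  rw [volume_pi, Measure.restrict_pi_pi,
    integral_fintype_prod_eq_prod (𝕜 := ℂ)
      (fun j (x : ℝ) => Complex.exp (2 * Real.pi * Complex.I * x) ^ d j)]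
  have h1 : ∀ k : ℤ, ∫ x in Set.Ioc (0 : ℝ) 1, Complex.exp (2 * Real.pi * Complex.I * x) ^ k =
      if k = 0 then 1 else 0 := by
    intro k
    split_ifs with hk
    · simp [hk]
    · have hc : (2 * Real.pi * Complex.I * k : ℂ) ≠ 0 :=
        mul_ne_zero Complex.two_pi_I_ne_zero (Int.cast_ne_zero.2 hk)
      have : ∀ x : ℝ, Complex.exp (2 * Real.pi * Complex.I * x) ^ k =
          Complex.exp (2 * Real.pi * Complex.I * k * x) := by
        intro x
        rw [← Complex.exp_int_mul]
        congr 1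
        ring
      simp_rw [this]
      rw [← intervalIntegral.integral_of_le zero_le_one, integral_exp_mul_complex hc]
      have h2 : Complex.exp (2 * Real.pi * Complex.I * k) = 1 := by
        rw [mul_comm]
        exact Complex.exp_int_mul_two_pi_mul_I k
      simp [h2]
  simp_rw [h1]
  split_ifs with hd
  · simp [hd]
  · obtain ⟨j, hj⟩ := Function.ne_iff.1 hd
    exact Finset.prod_eq_zero (Finset.mem_univ j) (if_neg hj)

theorem integrableOn_cube_character {r : ℕ} (d : Fin r → ℤ) :
    IntegrableOn (fun t : Fin r → ℝ => ∏ j, Complex.exp (2 * Real.pi * Complex.I * t j) ^ d j)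
      (Set.univ.pi fun _ : Fin r => Set.Ioc (0 : ℝ) 1) := by
  have hc : Continuous fun t : Fin r → ℝ =>
      ∏ j, Complex.exp (2 * Real.pi * Complex.I * t j) ^ d j := by
    refine continuous_finsetProd _ fun j _ => Continuous.zpow₀ (by fun_prop) _ fun t =>
      Or.inl (Complex.exp_ne_zero _)
  exact (hc.continuousOn.integrableOn_compact
    (isCompact_univ_pi fun _ : Fin r => isCompact_Icc (a := (0 : ℝ)) (b := 1))).mono_set
    (Set.pi_mono fun _ _ => Set.Ioc_subset_Icc_self)

theorem adotu_eq_adotv {n m : ℕ} (a : Fin n → ℂ) (t : Fin (n - m) → ℝ) :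
    adotu m a t = adotv m a fun j =>
      Units.mk0 (Complex.exp (2 * Real.pi * Complex.I * t j)) (Complex.exp_ne_zero _) :=
  rfl

theorem adotu_ne_zero {n m : ℕ} (a : Fin n → ℂˣ) (t : Fin (n - m) → ℝ) (j : Fin n) :
    adotu m (fun j => (a j : ℂ)) t j ≠ 0 := by
  unfold adotu
  split_ifs
  · exact (a j).ne_zero
  · exact mul_ne_zero (a j).ne_zero (Complex.exp_ne_zero _)

theorem setIntegral_cube_laurentEvalC {n m : ℕ} (hnm : m ≤ n) (p : (Fin n → ℤ) →₀ ℂ)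
    (a : Fin n → ℂˣ) (k : Fin (n - m) → ℤ) :
    ∫ t in (Set.univ.pi fun _ : Fin (n - m) => Set.Ioc (0 : ℝ) 1),
      laurentEvalC p (adotu m (fun j => (a j : ℂ)) t) *
        ∏ j, adotu m (fun j => (a j : ℂ)) t (tailIdx j) ^ (-k j) =
    (∑ e ∈ p.support with (fun j => e (tailIdx j)) = k, p e * ∏ i, (a i : ℂ) ^ e i) *
      ∏ j : Fin (n - m), (a (tailIdx j) : ℂ) ^ (-k j) := by
  have h : ∀ t : Fin (n - m) → ℝ, laurentEvalC p (adotu m (fun j => (a j : ℂ)) t) *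
        ∏ j, adotu m (fun j => (a j : ℂ)) t (tailIdx j) ^ (-k j) =
      ∑ e ∈ p.support, ((p e * ∏ i, (a i : ℂ) ^ e i) *
        ∏ j : Fin (n - m), (a (tailIdx j) : ℂ) ^ (-k j)) *
        ∏ j, Complex.exp (2 * Real.pi * Complex.I * t j) ^ (e (tailIdx j) - k j) := by
    intro t
    rw [adotu_eq_adotv, laurentEvalC_adotv hnm, Finset.sum_mul]
    refine Finset.sum_congr rfl fun e _ => ?_
    simp only [adotv_tailIdx, Units.val_mk0, mul_zpow, Finset.prod_mul_distrib, sub_eq_add_neg,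
      zpow_add₀ (Complex.exp_ne_zero _)]
    ring
  simp_rw [h]
  rw [integral_finsetSum _ fun e _ =>
    (integrableOn_cube_character fun j => e (tailIdx j) - k j).const_mul _]
  simp_rw [integral_const_mul, setIntegral_cube_character]
  rw [Finset.sum_filter, Finset.sum_mul]
  refine Finset.sum_congr rfl fun e _ => ?_
  have : (fun j => e (tailIdx j) - k j) = 0 ↔ (fun j => e (tailIdx j)) = k := by
    simp [funext_iff, sub_eq_zero]
  simp [this]

theorem emap_zero {n : ℕ} (m : ℕ) (q : ℝ) (b : Fin n → ℂ) : emap m q b 0 = b := by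
  ext j
  simp [emap]

theorem emap_ne_zero {n : ℕ} (m : ℕ) (q : ℝ) {b : Fin n → ℂ} (hb : ∀ j, b j ≠ 0)
    (lam : Fin m → ℂ) (j : Fin n) : emap m q b lam j ≠ 0 := by
  unfold emap
  split_ifs
  · exact mul_ne_zero (hb j) (Complex.exp_ne_zero _)
  · exact hb j

theorem analyticAt_laurentEvalC_emap {n m : ℕ} (q : ℝ) (p : (Fin n → ℤ) →₀ ℂ)
    {b : Fin n → ℂ} (hb : ∀ j, b j ≠ 0) (x : Fin m → ℂ) :
    AnalyticAt ℂ (fun lam => laurentEvalC p (emap m q b lam)) x := by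
  unfold laurentEvalC Finsupp.sum
  refine Finset.analyticAt_fun_sum _ fun e _ => analyticAt_const.mul
    (Finset.analyticAt_fun_prod _ fun j _ => AnalyticAt.fun_zpow ?_ (emap_ne_zero m q hb x j))
  unfold emap
  split_ifs with h
  · have : AnalyticAt ℂ (fun x : Fin m → ℂ => x ⟨j, h⟩) x :=
      (ContinuousLinearMap.proj (R := ℂ) (φ := fun _ : Fin m => ℂ) ⟨j, h⟩).analyticAt x
    exact analyticAt_const.mul (this.mul analyticAt_const).cexp
  · exact analyticAt_const

/-- (Proposition 3.8.) With `D = Σ_{β ∈ B} c_β ∂^β` a constant coefficient differential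
operator, `p` a Laurent polynomial not vanishing identically on `{a ⊙ v : v ∈ (ℂˣ)^{n-m}}`,
and `p̃` holomorphic near `0` with `p̃(0) ≠ 0`: if for every Laurent polynomial `ψ` the
integral over `u ∈ (S¹)^{n-m}` (with normalized Haar measure, parametrized by the unit
cube) of `[D_λ(p̃(λ)·p_{a⊙u}(λ)·ψ_{a⊙u}(λ))]_{λ=0}` vanishes, then `D = 0`, i.e.
`c_β = 0` for every `β ∈ B`. -/
theorem statement6 {n m : ℕ} (hm : 1 ≤ m) (hnm : m ≤ n)
    (q : ℝ) (hq : 1 < q)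
    (a : Fin n → ℂˣ)
    (B : Finset (Fin m → ℕ)) (c : (Fin m → ℕ) → ℂ)
    (p : (Fin n → ℤ) →₀ ℂ)
    (hp : ∃ v : Fin (n - m) → ℂˣ, laurentEvalC p (adotv m (fun j => (a j : ℂ)) v) ≠ 0)
    (ptilde : (Fin m → ℂ) → ℂ)
    (hptilde : AnalyticAt ℂ ptilde 0) (hptilde0 : ptilde 0 ≠ 0)
    (hint : ∀ ψ : (Fin n → ℤ) →₀ ℂ,
      (∫ t in (Set.univ.pi fun _ : Fin (n - m) => Set.Ioc (0:ℝ) 1),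
        ∑ β ∈ B, c β *
          mderiv β (fun lam =>
            ptilde lam *
            laurentEvalC p (emap m q (adotu m (fun j => (a j : ℂ)) t) lam) *
            laurentEvalC ψ (emap m q (adotu m (fun j => (a j : ℂ)) t) lam)) 0) = 0) :
    ∀ β ∈ B, c β = 0 := by
  classical
  by_contra! hne
  obtain ⟨β₁, hβ₁, hcβ₁⟩ := hne
  obtain ⟨γ, hγ⟩ := (B.filter fun β => c β ≠ 0).exists_maximal
    ⟨β₁, Finset.mem_filter.2 ⟨hβ₁, hcβ₁⟩⟩
  obtain ⟨hγB, hcγ⟩ := Finset.mem_filter.1 hγ.prop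
  obtain ⟨v, hv⟩ := hp
  obtain ⟨k, hk⟩ := exists_tail_coeff_ne_zero hnm hv
  obtain ⟨ψ, hψ⟩ : IsLaurent fun z : Fin n → ℂ =>
      (∏ j : Fin m, (((a (Fin.castLE hnm j) : ℂ))⁻¹ * z (Fin.castLE hnm j) ^ (1 : ℤ) +
        (-1)) ^ γ j) *
        ∏ j : Fin (n - m), z (tailIdx j) ^ (-k j) :=
    (IsLaurent.prod _ fun j => (((IsLaurent.const _).mul (IsLaurent.coord_zpow _ _)).add
      (IsLaurent.const _)).pow _).mul (IsLaurent.prod _ fun j => IsLaurent.coord_zpow _ _)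
  have hfac : ∀ t : Fin (n - m) → ℝ, HasExpFactor (Real.log q : ℂ) γ
      (ptilde 0 * (laurentEvalC p (adotu m (fun j => (a j : ℂ)) t) *
        ∏ j, adotu m (fun j => (a j : ℂ)) t (tailIdx j) ^ (-k j)))
      (fun lam => ptilde lam *
        laurentEvalC p (emap m q (adotu m (fun j => (a j : ℂ)) t) lam) *
        laurentEvalC ψ (emap m q (adotu m (fun j => (a j : ℂ)) t) lam)) := by
    intro t
    have hb := adotu_ne_zero (m := m) a t
    refine ⟨fun lam => ptilde lam *
      (laurentEvalC p (emap m q (adotu m (fun j => (a j : ℂ)) t) lam) *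
        ∏ j, adotu m (fun j => (a j : ℂ)) t (tailIdx j) ^ (-k j)),
      hptilde.mul ((analyticAt_laurentEvalC_emap q p hb 0).mul analyticAt_const), ?_,
      Filter.Eventually.of_forall fun lam => ?_⟩
    · simp only [emap_zero]
    · have h1 : ∀ j : Fin m, ((a (Fin.castLE hnm j) : ℂ))⁻¹ *
          emap m q (adotu m (fun j => (a j : ℂ)) t) lam (Fin.castLE hnm j) ^ (1 : ℤ) + (-1) =
          Complex.exp (lam j * Real.log q) - 1 := by
        intro j
        simp [emap, adotu, sub_eq_add_neg]
      have h2 : ∀ j : Fin (n - m),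
          emap m q (adotu m (fun j => (a j : ℂ)) t) lam (tailIdx j) =
          adotu m (fun j => (a j : ℂ)) t (tailIdx j) := by
        intro j
        simp [emap, tailIdx]
      simp only [hψ _ (emap_ne_zero m q hb lam), h1, h2]
      ring
  have hcalc : ∀ t : Fin (n - m) → ℝ, ∑ β ∈ B, c β * mderiv β (fun lam => ptilde lam *
        laurentEvalC p (emap m q (adotu m (fun j => (a j : ℂ)) t) lam) *
        laurentEvalC ψ (emap m q (adotu m (fun j => (a j : ℂ)) t) lam)) 0 =
      (c γ * (∏ j, ((γ j).factorial : ℂ) * (Real.log q : ℂ) ^ γ j) * ptilde 0) *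
        (laurentEvalC p (adotu m (fun j => (a j : ℂ)) t) *
          ∏ j, adotu m (fun j => (a j : ℂ)) t (tailIdx j) ^ (-k j)) := by
    intro t
    rw [Finset.sum_eq_single_of_mem γ hγB, (hfac t).mderiv_self]
    · ring
    · intro β hβ hβγ
      by_cases hcβ : c β = 0
      · rw [hcβ, zero_mul]
      · rw [(hfac t).mderiv_eq_zero, mul_zero]
        exact fun hle => hβγ (hγ.eq_of_le (Finset.mem_filter.2 ⟨hβ, hcβ⟩) hle).symm
  have h0 := hint ψ
  simp_rw [hcalc] at h0
  rw [integral_const_mul, setIntegral_cube_laurentEvalC hnm] at h0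
  have hlog : (Real.log q : ℂ) ≠ 0 := Complex.ofReal_ne_zero.2 (Real.log_pos hq).ne'
  refine mul_ne_zero (mul_ne_zero (mul_ne_zero hcγ ?_) hptilde0) (mul_ne_zero hk ?_) h0
  · exact Finset.prod_ne_zero_iff.2 fun j _ =>
      mul_ne_zero (Nat.cast_ne_zero.2 (Nat.factorial_ne_zero _)) (pow_ne_zero _ hlog)
  · exact Finset.prod_ne_zero_iff.2 fun j _ => zpow_ne_zero _ (a _).ne_zero
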